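/- arXiv:2601.14585 — 2 statements merged into one kernel-verified Lean document; each statement's English description precedes it below -/
import Mathlib

section
/- A cyclic polygon P is a star if and only if every two edges of P share a common point. -/
open Complex
open scoped Classical

noncomputable section

/-- The anticlockwise arc displacement from `u` to `v` on the unit circle, lying in `(0, 2π]`
(equal to `2π` when `v = u`). -/
def posArc (u v : ℂ) : ℝ :=
  if 0 < Complex.arg (v / u) then Complex.arg (v / u) else Complex.arg (v / u) + 2 * Real.pi

/-- `u, v, w` occur in anticlockwise order on the circle. -/
def ACW (u v w : ℂ) : Prop :=
  u ≠ v ∧ v ≠ w ∧ u ≠ w ∧ posArc u v < posArc u w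

/-- The open anticlockwise arc from `u` to `v`. -/
def arcOO (u v : ℂ) : Set ℂ := {x | x ≠ u ∧ x ≠ v ∧ posArc u x < posArc u v}

/-- The anticlockwise arc from `u` to `v`, open at `u` and closed at `v`. -/
def arcOC (u v : ℂ) : Set ℂ := {x | x ≠ u ∧ (x = v ∨ posArc u x < posArc u v)}

/-- The closed anticlockwise arc from `u` to `v`. -/
def arcCC (u v : ℂ) : Set ℂ := {x | x = u ∨ x = v ∨ (x ≠ u ∧ posArc u x < posArc u v)}

/-- The (undirected) angle `∠ x v z` at apex `v`. -/
def vangle (x v z : ℂ) : ℝ := |Complex.arg ((x - v) / (z - v))|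

/-- A cyclic polygon: a finite set of vertices on the unit circle together with a set of
directed edges such that every vertex has indegree and outdegree one, and any two
consecutive edges `uv`, `vw` have `u, v, w` in anticlockwise order. -/
structure CyclicPolygon where
  V : Finset ℂ
  E : Finset (ℂ × ℂ)
  nonempty : V.Nonempty
  onCircle : ∀ v ∈ V, ‖v‖ = 1
  endmem : ∀ e ∈ E, e.1 ∈ V ∧ e.2 ∈ V
  outdeg : ∀ v ∈ V, ∃! w, (v, w) ∈ E
  indeg : ∀ v ∈ V, ∃! u, (u, v) ∈ E
  acw : ∀ u v w : ℂ, (u, v) ∈ E → (v, w) ∈ E → ACW u v w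

namespace CyclicPolygon

/-- The successor `v⁺` of a vertex. -/
noncomputable def next (P : CyclicPolygon) (v : ℂ) : ℂ :=
  if h : ∃ w, (v, w) ∈ P.E then h.choose else v

/-- The predecessor `v⁻` of a vertex. -/
noncomputable def prev (P : CyclicPolygon) (v : ℂ) : ℂ :=
  if h : ∃ u, (u, v) ∈ P.E then h.choose else v

end CyclicPolygon

/-- The interior angle `∠ v⁻ v v⁺` of `P` at `v`. -/
def interiorAngle (P : CyclicPolygon) (v : ℂ) : ℝ :=
  vangle (P.prev v) v (P.next v)

/-- The length of an edge `uv`: the number of vertices on the open anticlockwise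
arc from `u` to `v`, plus one. -/
def edgeLength (P : CyclicPolygon) (u v : ℂ) : ℕ :=
  ((P.V : Set ℂ) ∩ arcOO u v).ncard + 1

/-- A `k`-star: a cyclic polygon with `2k+1` vertices all of whose edges have length `k`. -/
def IsKStar (S : CyclicPolygon) (k : ℕ) : Prop :=
  S.V.card = 2 * k + 1 ∧ ∀ e ∈ S.E, edgeLength S e.1 e.2 = k

/-- A star: a `k`-star for some positive integer `k`. -/
def IsStar (S : CyclicPolygon) : Prop := ∃ k : ℕ, 0 < k ∧ IsKStar S k

/-- The segment from `u` to `x` splits the interior angle `∠ u⁻ u u⁺` of `S` at `u`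
into the two (smaller, nonzero) angles `∠ u⁻ u x` and `∠ x u u⁺`. -/
def SplitsVertexAngle (S : CyclicPolygon) (u x : ℂ) : Prop :=
  u ∈ S.V ∧ 0 < vangle (S.prev u) u x ∧ 0 < vangle x u (S.next u) ∧
    vangle (S.prev u) u x + vangle x u (S.next u) = vangle (S.prev u) u (S.next u)

/-- `(u, v)` is a linkable pair for the pair of cyclic polygons `(S₁, S₂)`:
the segment `uv` splits the angle of `S₁` at `u` and the angle of `S₂` at `v`. -/
def LinkablePair (S₁ S₂ : CyclicPolygon) (u v : ℂ) : Prop :=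
  u ≠ v ∧ SplitsVertexAngle S₁ u v ∧ SplitsVertexAngle S₂ v u

/-- `u, v` is a linkable pair of vertices of the cyclic polygon `P`. -/
def Linkable (P : CyclicPolygon) (u v : ℂ) : Prop := LinkablePair P P u v

/-- `D` is a set of (undirected) diagonals of `P`, i.e. every member joins a linkable pair. -/
def IsDiagonalSet (P : CyclicPolygon) (D : Set (Sym2 ℂ)) : Prop :=
  ∀ u v : ℂ, s(u, v) ∈ D → Linkable P u v

/-- The set `D̃` of directed edges associated to a set of diagonals `D`. -/
def tilde (D : Set (Sym2 ℂ)) : Set (ℂ × ℂ) := {e | s(e.1, e.2) ∈ D}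

/-- The segment from `v` towards `x` splits the angle `∠ u v w`. -/
def SplitsAngle3 (u v w x : ℂ) : Prop :=
  0 < vangle u v x ∧ 0 < vangle x v w ∧ vangle u v x + vangle x v w = vangle u v w

/-- `𝒮` is a star decomposition of `P` with respect to the diagonal set `D`: the
cycle decomposition of `E ∪ D̃` determined by `f_next` (each cycle follows the
tightest turn, i.e. no diagonal of `D` splits the angle between two consecutive
edges of a cycle), all of whose cycles are stars. -/
def IsStarDecomp (P : CyclicPolygon) (D : Set (Sym2 ℂ)) (𝒮 : Finset CyclicPolygon) : Prop :=
  IsDiagonalSet P D ∧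
  (∀ S ∈ 𝒮, IsStar S ∧ (S.V : Set ℂ) ⊆ (P.V : Set ℂ)) ∧
  (∀ S ∈ 𝒮, (S.E : Set (ℂ × ℂ)) ⊆ (P.E : Set (ℂ × ℂ)) ∪ tilde D) ∧
  (∀ e ∈ (P.E : Set (ℂ × ℂ)) ∪ tilde D, ∃ S ∈ 𝒮, e ∈ S.E) ∧
  (∀ S₁ ∈ 𝒮, ∀ S₂ ∈ 𝒮, S₁ ≠ S₂ → ∀ e : ℂ × ℂ, e ∈ S₁.E → e ∉ S₂.E) ∧
  (∀ S ∈ 𝒮, ∀ u v w : ℂ, (u, v) ∈ S.E → (v, w) ∈ S.E →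
      ¬ ∃ x, s(v, x) ∈ D ∧ SplitsAngle3 u v w x)

/-- `P` admits a star decomposition with respect to `D`. -/
def HasStarDecomp (P : CyclicPolygon) (D : Set (Sym2 ℂ)) : Prop :=
  ∃ 𝒮 : Finset CyclicPolygon, IsStarDecomp P D 𝒮

/-- A maximal star decomposition: no proper superset of `D` admits a star decomposition. -/
def IsMaximalStarDecomp (P : CyclicPolygon) (D : Set (Sym2 ℂ))
    (𝒮 : Finset CyclicPolygon) : Prop :=
  IsStarDecomp P D 𝒮 ∧ ∀ D' : Set (Sym2 ℂ), D ⊂ D' → ¬ HasStarDecomp P D'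

/-- `D'` is obtained from `D` by a diagonal flip: remove one diagonal and add another. -/
def FlipStep (D D' : Set (Sym2 ℂ)) : Prop :=
  ∃ e f : Sym2 ℂ, e ∈ D ∧ f ∉ D ∧ D' = (D \ {e}) ∪ {f}

/-- The two chords `ab` and `cd` are crossing: they share no endpoint and
intersect inside the circle. -/
def Crossing (a b c d : ℂ) : Prop :=
  a ≠ c ∧ a ≠ d ∧ b ≠ c ∧ b ≠ d ∧ (openSegment ℝ a b ∩ openSegment ℝ c d).Nonempty

/-- The two chords `ab` and `cd` share a common point: they have a common
endvertex or intersect inside the circle. -/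
def ShareCommonPoint (a b c d : ℂ) : Prop :=
  a = c ∨ a = d ∨ b = c ∨ b = d ∨ (openSegment ℝ a b ∩ openSegment ℝ c d).Nonempty

/-- Two cyclic polygons have a pair of overlapped angles: a common vertex `y` and a vertex
`x` of either polygon lying on both arcs `⦅y⁺ y⁻⟧` (taken in each polygon). -/
def OverlappedAngles (S₁ S₂ : CyclicPolygon) : Prop :=
  ∃ y : ℂ, y ∈ S₁.V ∧ y ∈ S₂.V ∧
    ∃ x : ℂ, (x ∈ S₁.V ∨ x ∈ S₂.V) ∧
      x ∈ arcOC (S₁.next y) (S₁.prev y) ∧ x ∈ arcOC (S₂.next y) (S₂.prev y)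

/-- Two cyclic polygons are mutually independent: no two of their angles are overlapped. -/
def IndepPolygons (S₁ S₂ : CyclicPolygon) : Prop := ¬ OverlappedAngles S₁ S₂

/-- The edge `uv` of `P` is minimal: no edge `xy` of `P` has all vertices of the closed
arc from `x` to `y` inside the open arc from `u` to `v`. -/
def MinimalEdge (P : CyclicPolygon) (u v : ℂ) : Prop :=
  (u, v) ∈ P.E ∧
    ¬ ∃ x y : ℂ, (x, y) ∈ P.E ∧ ∀ z ∈ P.V, z ∈ arcCC x y → z ∈ arcOO u v

/-- `vs` enumerates the star `S` as `v₀ v₁ ⋯ v₂ₖ` with `v₁ = v`, `v₀ = v⁻` (so that `v⁻v`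
is an edge of `S`), each edge of `S` is an edge of `P` or a diagonal of `P`, and all the
edges `v₂ᵢ₋₁v₂ᵢ` are edges of `P`. -/
def IsBorderCandidate (P : CyclicPolygon) (v : ℂ) (S : CyclicPolygon) (k : ℕ)
    (vs : ℕ → ℂ) : Prop :=
  0 < k ∧ IsStar S ∧ S.V.card = 2 * k + 1 ∧
  (S.V : Set ℂ) ⊆ (P.V : Set ℂ) ∧
  vs 0 = P.prev v ∧ vs 1 = v ∧ vs (2 * k + 1) = vs 0 ∧
  (∀ x ∈ S.V, ∃ i ≤ 2 * k, vs i = x) ∧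
  (∀ i ≤ 2 * k, (vs i, vs (i + 1)) ∈ S.E) ∧
  (∀ i ≤ 2 * k, (vs i, vs (i + 1)) ∈ P.E ∨ Linkable P (vs i) (vs (i + 1))) ∧
  (∀ i : ℕ, 1 ≤ i → i ≤ k → (vs (2 * i - 1), vs (2 * i)) ∈ P.E)

/-- The angle sequence `(∠v₁v₂v₃, ∠v₃v₄v₅, …, ∠v₂ₖ₋₁v₂ₖv₀)` of an enumerated star. -/
noncomputable def angleList (vs : ℕ → ℂ) (k : ℕ) : List ℝ :=
  (List.range k).map fun i => vangle (vs (2 * i + 1)) (vs (2 * i + 2)) (vs (2 * i + 3))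

/-- `S` is the border star `S*(P, v)`: among all border candidates, its angle sequence is
lexicographically minimal. -/
def IsBorderStar (P : CyclicPolygon) (v : ℂ) (S : CyclicPolygon) : Prop :=
  ∃ (k : ℕ) (vs : ℕ → ℂ), IsBorderCandidate P v S k vs ∧
    ∀ (S' : CyclicPolygon) (k' : ℕ) (vs' : ℕ → ℂ), IsBorderCandidate P v S' k' vs' →
      ¬ List.Lex (· < ·) (angleList vs' k') (angleList vs k)


/-- Orientation determinant of three points. -/
def ori (a b c : ℂ) : ℝ := (b.re - a.re) * (c.im - a.im) - (b.im - a.im) * (c.re - a.re)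

lemma ori_rot (a b c : ℂ) : ori b c a = ori a b c := by unfold ori; ring
lemma ori_swap (a b c : ℂ) : ori b a c = - ori a b c := by unfold ori; ring
lemma ori_swap' (a b c : ℂ) : ori a c b = - ori a b c := by unfold ori; ring

lemma posArc_spec {a b : ℂ} (ha : ‖a‖ = 1) (hb : ‖b‖ = 1) (hab : b ≠ a) :
    0 < posArc a b ∧ posArc a b < 2 * Real.pi ∧
      b = a * (Real.cos (posArc a b) + Real.sin (posArc a b) * I) := by
  have ha0 : a ≠ 0 := by intro h; simp [h] at ha
  have hn : ‖b / a‖ = 1 := by simp [ha, hb]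
  have hpi := Real.pi_pos
  have h1 := Complex.arg_le_pi (b / a)
  have h2 := Complex.neg_pi_lt_arg (b / a)
  have h3 : b / a = Real.cos (arg (b / a)) + Real.sin (arg (b / a)) * I := by
    have := Complex.norm_mul_cos_add_sin_mul_I (b / a)
    rw [hn] at this
    push_cast
    simpa using this.symm
  have h4 : b = a * (Real.cos (arg (b / a)) + Real.sin (arg (b / a)) * I) := by
    rw [← h3]; field_simp
  have h5 : arg (b / a) ≠ 0 := by
    intro h
    rw [h] at h4
    simp at h4
    exact hab h4
  unfold posArc
  split_ifs with h
  · exact ⟨h, by linarith, h4⟩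
  · have : arg (b / a) < 0 := lt_of_le_of_ne (not_lt.mp h) h5
    refine ⟨by linarith, by linarith, ?_⟩
    rw [Real.cos_add_two_pi, Real.sin_add_two_pi]; exact h4

lemma ori_formula {a b c : ℂ} (ha : ‖a‖ = 1) (hb : ‖b‖ = 1) (hc : ‖c‖ = 1)
    (hab : b ≠ a) (hac : c ≠ a) :
    ori a b c = 4 * Real.sin (posArc a b / 2) * Real.sin (posArc a c / 2) *
      Real.sin (posArc a c / 2 - posArc a b / 2) := by
  obtain ⟨-, -, h1⟩ := posArc_spec ha hb hab
  obtain ⟨-, -, h2⟩ := posArc_spec ha hc hac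
  generalize posArc a b = β at *
  generalize posArc a c = γ at *
  obtain ⟨x, rfl⟩ : ∃ x, β = 2 * x := ⟨β / 2, by ring⟩
  obtain ⟨y, rfl⟩ : ∃ y, γ = 2 * y := ⟨γ / 2, by ring⟩
  have hna : a.re * a.re + a.im * a.im = 1 := by
    have := Complex.normSq_eq_norm_sq a
    rw [ha, Complex.normSq_apply] at this; simpa using this
  have b1 := congrArg Complex.re h1
  have b2 := congrArg Complex.im h1
  have c1 := congrArg Complex.re h2
  have c2 := congrArg Complex.im h2
  simp only [Complex.mul_re, Complex.mul_im, Complex.add_re, Complex.add_im, Complex.ofReal_re,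
    Complex.ofReal_im, Complex.I_re, Complex.I_im, mul_zero, mul_one, zero_mul, sub_zero,
    add_zero, zero_add] at b1 b2 c1 c2
  have e1 : 2 * x / 2 = x := by ring
  have e2 : 2 * y / 2 = y := by ring
  rw [e1, e2, Real.sin_sub]
  unfold ori
  have hb' : Real.cos (2 * x) = 1 - 2 * Real.sin x ^ 2 := by
    rw [Real.cos_two_mul, Real.cos_sq']; ring
  have hc' : Real.cos (2 * y) = 1 - 2 * Real.sin y ^ 2 := by
    rw [Real.cos_two_mul, Real.cos_sq']; ring
  rw [hb', Real.sin_two_mul] at b1 b2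
  rw [hc', Real.sin_two_mul] at c1 c2
  rw [b1, b2, c1, c2]
  linear_combination (4 * Real.sin x * Real.sin y *
    (Real.sin y * Real.cos x - Real.cos y * Real.sin x)) * hna

lemma sin_half_pos {t : ℝ} (h0 : 0 < t) (h1 : t < 2 * Real.pi) : 0 < Real.sin (t / 2) :=
  Real.sin_pos_of_pos_of_lt_pi (by linarith) (by linarith)

lemma ori_pos_of_lt {a b c : ℂ} (ha : ‖a‖ = 1) (hb : ‖b‖ = 1) (hc : ‖c‖ = 1)
    (hab : b ≠ a) (hac : c ≠ a) (h : posArc a b < posArc a c) : 0 < ori a b c := by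
  rw [ori_formula ha hb hc hab hac]
  obtain ⟨p1, p2, -⟩ := posArc_spec ha hb hab
  obtain ⟨q1, q2, -⟩ := posArc_spec ha hc hac
  have := sin_half_pos p1 p2
  have := sin_half_pos q1 q2
  have : 0 < Real.sin (posArc a c / 2 - posArc a b / 2) :=
    Real.sin_pos_of_pos_of_lt_pi (by linarith) (by linarith)
  positivity

lemma ori_pos_iff {a b c : ℂ} (ha : ‖a‖ = 1) (hb : ‖b‖ = 1) (hc : ‖c‖ = 1)
    (hab : b ≠ a) (hac : c ≠ a) : 0 < ori a b c ↔ posArc a b < posArc a c := by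
  refine ⟨fun h => ?_, ori_pos_of_lt ha hb hc hab hac⟩
  by_contra hn
  rcases lt_or_eq_of_le (not_lt.mp hn) with h' | h'
  · have := ori_pos_of_lt ha hc hb hac hab h'
    rw [ori_swap'] at this; linarith
  · rw [ori_formula ha hb hc hab hac, h'] at h
    simp at h

lemma ori_ne_zero {a b c : ℂ} (ha : ‖a‖ = 1) (hb : ‖b‖ = 1) (hc : ‖c‖ = 1)
    (hab : b ≠ a) (hac : c ≠ a) (hbc : b ≠ c) : ori a b c ≠ 0 := by
  intro h
  have h1 : ¬ posArc a b < posArc a c := by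
    rw [← ori_pos_iff ha hb hc hab hac, h]; simp
  have h2 : ¬ posArc a c < posArc a b := by
    rw [← ori_pos_iff ha hc hb hac hab, ori_swap', h]; simp
  have h3 : posArc a b = posArc a c := le_antisymm (not_lt.mp h2) (not_lt.mp h1)
  apply hbc
  rw [(posArc_spec ha hb hab).2.2, (posArc_spec ha hc hac).2.2, h3]

lemma ori_ne {a b c : ℂ} (h : 0 < ori a b c) : b ≠ a ∧ c ≠ a ∧ b ≠ c := by
  refine ⟨?_, ?_, ?_⟩ <;> rintro rfl <;> unfold ori at h <;> ring_nf at h <;> simp at h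

lemma ori_trans {a b c d : ℂ} (ha : ‖a‖ = 1) (hb : ‖b‖ = 1) (hc : ‖c‖ = 1) (hd : ‖d‖ = 1)
    (h1 : 0 < ori a b c) (h2 : 0 < ori a c d) : 0 < ori a b d := by
  obtain ⟨n1, n2, -⟩ := ori_ne h1
  obtain ⟨-, n4, -⟩ := ori_ne h2
  rw [ori_pos_iff ha hb hc n1 n2] at h1
  rw [ori_pos_iff ha hc hd n2 n4] at h2
  rw [ori_pos_iff ha hb hd n1 n4]
  exact h1.trans h2

lemma ori_zero_of_meet {a b c d : ℂ}
    (h : (openSegment ℝ a b ∩ openSegment ℝ c d).Nonempty) :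
    ∃ s t : ℝ, 0 < s ∧ 0 < t ∧ s * ori a b c + t * ori a b d = 0 := by
  obtain ⟨z, ⟨p, q, hp, hq, hpq, hz⟩, ⟨s, t, hs, ht, hst, hz'⟩⟩ := h
  refine ⟨s, t, hs, ht, ?_⟩
  have e1 := congrArg Complex.re hz
  have e2 := congrArg Complex.im hz
  have f1 := congrArg Complex.re hz'
  have f2 := congrArg Complex.im hz'
  simp at e1 e2 f1 f2
  have hp : p = 1 - q := by linarith
  have hs : s = 1 - t := by linarith
  subst hp hs
  unfold ori
  linear_combination (b.re - a.re) * (f2 - e2) - (b.im - a.im) * (f1 - e1)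

lemma meet_of_ori {a b c d : ℂ} (h1 : 0 < ori a b c) (h2 : ori a b d < 0)
    (h3 : ori c d a < 0) (h4 : 0 < ori c d b) :
    (openSegment ℝ a b ∩ openSegment ℝ c d).Nonempty := by
  have hD : 0 < ori a b c - ori a b d := by linarith
  have hE : ori c d b - ori c d a = ori a b c - ori a b d := by unfold ori; ring
  refine ⟨((ori c d b / (ori a b c - ori a b d) : ℝ) : ℂ) * a +
    ((-ori c d a / (ori a b c - ori a b d) : ℝ) : ℂ) * b,
    ⟨ori c d b / (ori a b c - ori a b d), -ori c d a / (ori a b c - ori a b d), ?_, ?_, ?_, ?_⟩,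
    ⟨-ori a b d / (ori a b c - ori a b d), ori a b c / (ori a b c - ori a b d), ?_, ?_, ?_, ?_⟩⟩
  · positivity
  · exact div_pos (by linarith) hD
  · rw [← add_div, ← sub_eq_add_neg, hE, div_self hD.ne']
  · simp
  · exact div_pos (by linarith) hD
  · positivity
  · rw [← add_div, neg_add_eq_sub, div_self hD.ne']
  · have hD' := hD.ne'
    apply Complex.ext <;>
      simp only [Complex.add_re, Complex.add_im, Complex.smul_re, Complex.smul_im,
        Complex.re_ofReal_mul, Complex.im_ofReal_mul, smul_eq_mul] <;>
      field_simp <;> unfold ori <;> ring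

/-- vertices strictly to the right of the chord. -/
def rightV (P : CyclicPolygon) (u v : ℂ) : Finset ℂ := P.V.filter fun x => ori u v x < 0

lemma edge_next (P : CyclicPolygon) {v : ℂ} (hv : v ∈ P.V) : (v, P.next v) ∈ P.E := by
  have h : ∃ w, (v, w) ∈ P.E := (P.outdeg v hv).exists
  unfold CyclicPolygon.next
  rw [dif_pos h]
  exact h.choose_spec

lemma edge_in_unique (P : CyclicPolygon) {x y v : ℂ} (hx : (x, v) ∈ P.E) (hy : (y, v) ∈ P.E) :
    x = y := (P.indeg v (P.endmem _ hx).2).unique hx hy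

lemma edge_ori (P : CyclicPolygon) {u v w : ℂ} (h1 : (u, v) ∈ P.E) (h2 : (v, w) ∈ P.E) :
    0 < ori u v w := by
  obtain ⟨n1, n2, n3, h⟩ := P.acw u v w h1 h2
  exact ori_pos_of_lt (P.onCircle _ (P.endmem _ h1).1) (P.onCircle _ (P.endmem _ h1).2)
    (P.onCircle _ (P.endmem _ h2).2) n1.symm n3.symm h

lemma edge_ne (P : CyclicPolygon) {u v : ℂ} (h1 : (u, v) ∈ P.E) : u ≠ v :=
  (ori_ne (edge_ori P h1 (edge_next P (P.endmem _ h1).2))).1.symm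

lemma edgeLength_eq (P : CyclicPolygon) {u v : ℂ} (hu : u ∈ P.V) (hv : v ∈ P.V) (huv : u ≠ v) :
    edgeLength P u v = (rightV P u v).card + 1 := by
  unfold edgeLength
  rw [← Set.ncard_coe_finset]
  congr 2
  ext x
  simp only [rightV, Set.mem_inter_iff, Finset.mem_coe, Finset.mem_filter, arcOO, Set.mem_setOf_eq]
  refine and_congr_right fun hx => ?_
  have Hu := P.onCircle _ hu
  have Hv := P.onCircle _ hv
  have Hx := P.onCircle _ hx
  have key : ori u v x < 0 ↔ 0 < ori u x v := by rw [ori_swap' u v x]; simp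
  rw [key]
  constructor
  · rintro ⟨n1, n2, h⟩
    exact ori_pos_of_lt Hu Hx Hv n1 huv.symm h
  · intro h
    obtain ⟨n1, n2, n3⟩ := ori_ne h
    exact ⟨n1, n3, (ori_pos_iff Hu Hx Hv n1 n2).1 h⟩

lemma card_split (P : CyclicPolygon) {u v : ℂ} (hu : u ∈ P.V) (hv : v ∈ P.V) (huv : u ≠ v) :
    P.V.card = (rightV P u v).card + (rightV P v u).card + 2 := by
  have h1 : P.V = (rightV P u v ∪ rightV P v u) ∪ {u, v} := by
    ext x
    simp only [rightV, Finset.mem_union, Finset.mem_filter, Finset.mem_insert,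
      Finset.mem_singleton, ori_swap u v]
    constructor
    · intro hx
      by_cases h1 : x = u
      · tauto
      by_cases h2 : x = v
      · tauto
      rcases lt_or_gt_of_ne (ori_ne_zero (P.onCircle _ hu) (P.onCircle _ hv) (P.onCircle _ hx)
        huv.symm h1 (Ne.symm h2)) with h | h
      · tauto
      · exact Or.inl (Or.inr ⟨hx, by linarith⟩)
    · rintro ((h | h) | (rfl | rfl))
      exacts [h.1, h.1, hu, hv]
  have e1 : ori u v u = 0 := by unfold ori; ring
  have e2 : ori u v v = 0 := by unfold ori; ring
  rw [h1, Finset.card_union_of_disjoint, Finset.card_union_of_disjoint, Finset.card_pair huv]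
  · rw [Finset.disjoint_left]
    intro x hx hx'
    simp only [rightV, Finset.mem_filter, ori_swap u v] at hx hx'
    linarith [hx.2, hx'.2]
  · rw [Finset.disjoint_left]
    intro x hx hx'
    simp only [rightV, Finset.mem_union, Finset.mem_filter, Finset.mem_insert,
      Finset.mem_singleton, ori_swap u v] at hx hx'
    rcases hx' with rfl | rfl <;> simp [e1, e2] at hx

lemma nested_card (P : CyclicPolygon) {p q c d : ℂ} (hp : p ∈ P.V) (hq : q ∈ P.V)
    (hc : c ∈ P.V) (hd : d ∈ P.V) (h1 : ori p q c < 0) (h2 : ori p q d < 0)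
    (h3 : 0 < ori p c d) : (rightV P c d).card + 2 ≤ (rightV P p q).card := by
  have Hp := P.onCircle _ hp
  have Hq := P.onCircle _ hq
  have Hc := P.onCircle _ hc
  have Hd := P.onCircle _ hd
  have hcd : c ≠ d := (ori_ne h3).2.2
  have hdis : Disjoint (rightV P c d) {c, d} := by
    have e1 : ori c d c = 0 := by unfold ori; ring
    have e2 : ori c d d = 0 := by unfold ori; ring
    rw [Finset.disjoint_left]
    intro x hx hx'
    simp only [rightV, Finset.mem_filter, Finset.mem_insert, Finset.mem_singleton] at hx hx'
    rcases hx' with rfl | rfl <;> simp [e1, e2] at hx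
  rw [← Finset.card_pair hcd, ← Finset.card_union_of_disjoint hdis]
  apply Finset.card_le_card
  intro x hx
  simp only [rightV, Finset.mem_union, Finset.mem_filter, Finset.mem_insert,
      Finset.mem_singleton] at hx ⊢
  rcases hx with ⟨hx, h⟩ | (rfl | rfl)
  · refine ⟨hx, ?_⟩
    have Hx := P.onCircle _ hx
    have g1 : 0 < ori d c x := by rw [ori_swap c d]; linarith
    have g2 : 0 < ori d p c := by rw [ori_rot c d p, ori_rot p c d]; exact h3
    have g3 := ori_trans Hd Hp Hc Hx g2 g1
    rw [← ori_rot, ← ori_rot] at g3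
    have g3' : 0 < ori p x d := by
      have : ori p x d = ori x d p := (ori_rot p x d).symm
      unfold ori at *; linarith
    have g4 : 0 < ori p d q := by rw [ori_swap' p q d]; linarith
    have g5 := ori_trans Hp Hx Hd Hq g3' g4
    rw [ori_swap' p q x] at g5; linarith
  · exact ⟨hc, h1⟩
  · exact ⟨hd, h2⟩

/-- crossing from sign change -/
lemma meet_of_sides {a b c d : ℂ} (ha : ‖a‖ = 1) (hb : ‖b‖ = 1) (hc : ‖c‖ = 1) (hd : ‖d‖ = 1)
    (h1 : 0 < ori a b c) (h2 : ori a b d < 0) :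
    (openSegment ℝ a b ∩ openSegment ℝ c d).Nonempty := by
  have h2' : 0 < ori a d b := by rw [ori_swap' a b d]; linarith
  have g1 := ori_trans ha hd hb hc h2' h1
  have h3 : 0 < ori b c a := by rw [ori_rot]; exact h1
  have h4 : 0 < ori b a d := by rw [ori_swap a b]; linarith
  have g2 := ori_trans hb hc ha hd h3 h4
  refine meet_of_ori h1 h2 ?_ ?_
  · rw [ori_rot a c d, ori_swap' a d c]; linarith
  · rw [ori_rot b c d]; exact g2

lemma star_forward (P : CyclicPolygon) (h : IsStar P) :
    ∀ e ∈ P.E, ∀ f ∈ P.E, ShareCommonPoint e.1 e.2 f.1 f.2 := by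
  obtain ⟨k, hk, hcard, hlen⟩ := h
  have hL : ∀ a b : ℂ, (a, b) ∈ P.E → (rightV P a b).card + 1 = k ∧ (rightV P b a).card = k := by
    intro a b hab
    have ha := (P.endmem _ hab).1
    have hb := (P.endmem _ hab).2
    have h1 := hlen _ hab
    rw [edgeLength_eq P ha hb (edge_ne P hab)] at h1
    have h2 := card_split P ha hb (edge_ne P hab)
    simp only at h1 h2
    omega
  rintro ⟨a, b⟩ he ⟨c, d⟩ hf
  simp only
  obtain ⟨ha, hb⟩ := P.endmem _ he
  obtain ⟨hc, hd⟩ := P.endmem _ hf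
  simp only at ha hb hc hd
  obtain ⟨k1, k2⟩ := hL _ _ he
  obtain ⟨k3, k4⟩ := hL _ _ hf
  have hab := edge_ne P he
  have hcd := edge_ne P hf
  have Ha := P.onCircle _ ha
  have Hb := P.onCircle _ hb
  have Hc := P.onCircle _ hc
  have Hd := P.onCircle _ hd
  unfold ShareCommonPoint
  by_contra! hcon
  obtain ⟨n1, n2, n3, n4, hno⟩ := hcon
  have hno' : ¬ (openSegment ℝ a b ∩ openSegment ℝ c d).Nonempty := by
    rw [hno]; exact Set.not_nonempty_empty
  -- same side gives nested arcs
  have main : ∀ p q : ℂ, p ∈ P.V → q ∈ P.V → p ≠ c → p ≠ d → (rightV P p q).card ≤ k →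
      ori p q c < 0 → ori p q d < 0 → False := by
    intro p q hp hq m1 m2 hle g1 g2
    rcases lt_or_gt_of_ne (ori_ne_zero (P.onCircle _ hp) Hc Hd m1.symm m2.symm hcd) with g | g
    · have := nested_card P hp hq hd hc g2 g1 (by rw [ori_swap' p c d]; linarith)
      omega
    · have := nested_card P hp hq hc hd g1 g2 g
      omega
  rcases lt_or_gt_of_ne (ori_ne_zero Ha Hb Hc hab.symm n1.symm n3) with g1 | g1 <;>
  rcases lt_or_gt_of_ne (ori_ne_zero Ha Hb Hd hab.symm n2.symm n4) with g2 | g2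
  · exact main a b ha hb n1 n2 (by omega) g1 g2
  · apply hno'
    rw [openSegment_symm ℝ c d]
    exact meet_of_sides Ha Hb Hd Hc g2 g1
  · exact hno' (meet_of_sides Ha Hb Hc Hd g1 g2)
  · refine main b a hb ha n3 n4 (by omega) ?_ ?_ <;> rw [ori_swap a b] <;> linarith

lemma next_injOn (P : CyclicPolygon) : Set.InjOn P.next (P.V : Set ℂ) := by
  intro x hx y hy hxy
  have h1 := edge_next P hx
  have h2 := edge_next P hy
  rw [← hxy] at h2
  exact edge_in_unique P h1 h2

lemma star_backward (P : CyclicPolygon)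
    (h : ∀ e ∈ P.E, ∀ f ∈ P.E, ShareCommonPoint e.1 e.2 f.1 f.2) : IsStar P := by
  have key : ∀ u v : ℂ, (u, v) ∈ P.E →
      (rightV P u v).card + 1 = (rightV P v u).card := by
    intro u v huv
    obtain ⟨hu, hv⟩ := P.endmem _ huv
    simp only at hu hv
    have hne := edge_ne P huv
    have e1 : ori u v u = 0 := by unfold ori; ring
    have e2 : ori u v v = 0 := by unfold ori; ring
    have step : ∀ x ∈ P.V, x ≠ u → x ≠ v → P.next x = u ∨
        (ori u v x < 0 ∧ 0 < ori u v (P.next x)) ∨ (0 < ori u v x ∧ ori u v (P.next x) < 0) := by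
      intro x hx m1 m2
      have hxy := edge_next P hx
      have hy := (P.endmem _ hxy).2
      simp only at hy
      by_cases hyu : P.next x = u
      · exact Or.inl hyu
      right
      have hyv : P.next x ≠ v := by
        intro hyv
        rw [hyv] at hxy
        exact m1 (edge_in_unique P hxy huv)
      have hs := h _ huv _ hxy
      unfold ShareCommonPoint at hs
      simp only at hs
      rcases hs with hs | hs | hs | hs | hs
      · exact absurd hs.symm m1
      · exact absurd hs.symm hyu
      · exact absurd hs.symm m2
      · exact absurd hs.symm hyv
      obtain ⟨s, t, hs, ht, hst⟩ := ori_zero_of_meet hs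
      have z1 := ori_ne_zero (P.onCircle _ hu) (P.onCircle _ hv) (P.onCircle _ hx) hne.symm m1
        (Ne.symm m2)
      have z2 := ori_ne_zero (P.onCircle _ hu) (P.onCircle _ hv) (P.onCircle _ hy) hne.symm hyu
        (Ne.symm hyv)
      rcases lt_or_gt_of_ne z1 with g1 | g1 <;> rcases lt_or_gt_of_ne z2 with g2 | g2
      · nlinarith [mul_pos hs (neg_pos.2 g1), mul_pos ht (neg_pos.2 g2)]
      · exact Or.inl ⟨g1, g2⟩
      · exact Or.inr ⟨g1, g2⟩
      · nlinarith [mul_pos hs g1, mul_pos ht g2]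
    have hmem : ∀ x, x ∈ rightV P u v ↔ x ∈ P.V ∧ ori u v x < 0 := by simp [rightV]
    have hmem' : ∀ x, x ∈ rightV P v u ↔ x ∈ P.V ∧ 0 < ori u v x := by
      intro x; simp [rightV, ori_swap u v]
    have hnV : ∀ x ∈ P.V, P.next x ∈ P.V := fun x hx => (P.endmem _ (edge_next P hx)).2
    have hvn : v ∉ rightV P u v := by rw [hmem, e2]; simp
    have hun : u ∉ rightV P u v := by rw [hmem, e1]; simp
    have hn1 : ∀ x, ori u v x ≠ 0 → x ≠ u ∧ x ≠ v := by
      intro x hx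
      constructor <;> rintro rfl
      · exact hx e1
      · exact hx e2
    apply le_antisymm
    · rw [← Finset.card_insert_of_notMem hvn]
      apply Finset.card_le_card_of_injOn P.next
      · intro x hx
        rw [Finset.mem_coe, Finset.mem_insert] at hx
        rw [Finset.mem_coe, hmem']
        rcases hx with rfl | hx
        · exact ⟨hnV _ hv, edge_ori P huv (edge_next P hv)⟩
        · rw [hmem] at hx
          obtain ⟨m1, m2⟩ := hn1 x hx.2.ne
          refine ⟨hnV _ hx.1, ?_⟩
          rcases step x hx.1 m1 m2 with g | g | g
          · have h1 := edge_next P hx.1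
            rw [g] at h1
            have h2 := edge_ori P h1 huv
            rw [← ori_rot] at h2
            linarith [hx.2]
          · exact g.2
          · linarith [hx.2, g.1]
      · apply (next_injOn P).mono
        intro x hx
        rw [Finset.mem_coe, Finset.mem_insert] at hx
        rcases hx with rfl | hx
        · exact hv
        · exact ((hmem x).1 hx).1
    · rw [← Finset.card_insert_of_notMem hun]
      apply Finset.card_le_card_of_injOn P.next
      · intro x hx
        rw [Finset.mem_coe, hmem'] at hx
        rw [Finset.mem_coe, Finset.mem_insert, hmem]
        obtain ⟨m1, m2⟩ := hn1 x hx.2.ne'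
        rcases step x hx.1 m1 m2 with g | g | g
        · exact Or.inl g
        · linarith [hx.2, g.1]
        · exact Or.inr ⟨hnV _ hx.1, g.2⟩
      · apply (next_injOn P).mono
        intro x hx
        exact ((hmem' x).1 hx).1
  obtain ⟨v₀, hv₀⟩ := P.nonempty
  have h0 := edge_next P hv₀
  refine ⟨(rightV P v₀ (P.next v₀)).card + 1, by omega, ?_, ?_⟩
  · have := key _ _ h0
    have := card_split P hv₀ (P.endmem _ h0).2 (edge_ne P h0)
    simp only at this
    omega
  · rintro ⟨a, b⟩ he
    obtain ⟨ha, hb⟩ := P.endmem _ he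
    simp only at ha hb ⊢
    rw [edgeLength_eq P ha hb (edge_ne P he)]
    have := key _ _ h0
    have := card_split P hv₀ (P.endmem _ h0).2 (edge_ne P h0)
    have := key _ _ he
    have := card_split P ha hb (edge_ne P he)
    simp only at *
    omega

/-- A cyclic polygon is a star if and only if every two of its edges share a
common point. -/
theorem star_iff_pairwise_common_point (P : CyclicPolygon) :
    IsStar P ↔ ∀ e ∈ P.E, ∀ f ∈ P.E, ShareCommonPoint e.1 e.2 f.1 f.2 := by
  exact ⟨star_forward P, star_backward P⟩

end
end

section
/- Let P be a cyclic polygon with n vertices, p linkable pairs, and rotation number r. If P admits a star decomposition, then p ≥ (n−2r)(n−2r−1)/2. -/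
open Complex
open scoped Classical

noncomputable section

theorem arg_inj_circle {u v : ℂ} (hu : ‖u‖ = 1) (hv : ‖v‖ = 1) (h : arg u = arg v) : u = v :=
  Complex.ext_norm_arg (hu.trans hv.symm) h

theorem ne_zero_circle {u : ℂ} (hu : ‖u‖ = 1) : u ≠ 0 := by
  intro h; rw [h] at hu; simp at hu

theorem posArc_arg {u v : ℂ} (hu : ‖u‖ = 1) (hv : ‖v‖ = 1) :
    posArc u v = if arg u < arg v then arg v - arg u else arg v - arg u + 2 * Real.pi := by
  have h := Complex.arg_div_coe_angle (ne_zero_circle hv) (ne_zero_circle hu)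
  rw [← Real.Angle.coe_sub, Real.Angle.angle_eq_iff_two_pi_dvd_sub] at h
  obtain ⟨m, hm⟩ := h
  have h1 := Complex.arg_le_pi u
  have h2 := Complex.neg_pi_lt_arg u
  have h3 := Complex.arg_le_pi v
  have h4 := Complex.neg_pi_lt_arg v
  have h5 := Complex.arg_le_pi (v / u)
  have h6 := Complex.neg_pi_lt_arg (v / u)
  have hp := Real.pi_pos
  have hm1 : m < 2 := by
    by_contra hc
    have : (2 : ℝ) ≤ m := by exact_mod_cast not_lt.mp hc
    nlinarith
  have hm2 : -2 < m := by
    by_contra hc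
    have : (m : ℝ) ≤ -2 := by exact_mod_cast not_lt.mp hc
    nlinarith
  unfold posArc
  have : m = -1 ∨ m = 0 ∨ m = 1 := by omega
  rcases this with rfl | rfl | rfl <;> push_cast at hm <;> split_ifs <;> linarith

theorem posArc_pos {u v : ℂ} (hu : ‖u‖ = 1) (hv : ‖v‖ = 1) : 0 < posArc u v := by
  rw [posArc_arg hu hv]
  have h1 := Complex.arg_le_pi u
  have h4 := Complex.neg_pi_lt_arg v
  split_ifs <;> linarith

theorem posArc_le {u v : ℂ} (hu : ‖u‖ = 1) (hv : ‖v‖ = 1) : posArc u v ≤ 2 * Real.pi := by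
  rw [posArc_arg hu hv]
  have h1 := Complex.arg_le_pi v
  have h4 := Complex.neg_pi_lt_arg u
  split_ifs <;> linarith

theorem posArc_self {u : ℂ} (hu : ‖u‖ = 1) : posArc u u = 2 * Real.pi := by
  rw [posArc_arg hu hu]; simp

theorem posArc_inj {u v w : ℂ} (hu : ‖u‖ = 1) (hv : ‖v‖ = 1) (hw : ‖w‖ = 1)
    (h : posArc u v = posArc u w) : v = w := by
  rw [posArc_arg hu hv, posArc_arg hu hw] at h
  apply arg_inj_circle hv hw
  have h1 := Complex.arg_le_pi v
  have h4 := Complex.neg_pi_lt_arg v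
  have h2 := Complex.arg_le_pi w
  have h3 := Complex.neg_pi_lt_arg w
  split_ifs at h <;> linarith

theorem posArc_lt {u v : ℂ} (hu : ‖u‖ = 1) (hv : ‖v‖ = 1) (h : u ≠ v) :
    posArc u v < 2 * Real.pi := by
  refine lt_of_le_of_ne (posArc_le hu hv) fun h' => h ?_
  rw [← posArc_self hu] at h'
  exact (posArc_inj hu hv hu h').symm

theorem posArc_base {u v w : ℂ} (hu : ‖u‖ = 1) (hv : ‖v‖ = 1) (hw : ‖w‖ = 1) :
    posArc v w = if posArc u v < posArc u w then posArc u w - posArc u v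
      else posArc u w - posArc u v + 2 * Real.pi := by
  rw [posArc_arg hu hv, posArc_arg hu hw, posArc_arg hv hw]
  have h1 := Complex.arg_le_pi v
  have h4 := Complex.neg_pi_lt_arg v
  have h2 := Complex.arg_le_pi w
  have h3 := Complex.neg_pi_lt_arg w
  have hp := Real.pi_pos
  split_ifs <;> linarith

theorem posArc_add {u v : ℂ} (hu : ‖u‖ = 1) (hv : ‖v‖ = 1) (h : u ≠ v) :
    posArc u v + posArc v u = 2 * Real.pi := by
  have h1 := posArc_lt hu hv h
  rw [posArc_base hu hv hu, posArc_self hu, if_pos h1]; ring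

/-- Inscribed angle theorem. -/
theorem vangle_eq {x v z : ℂ} (hx : ‖x‖ = 1) (hv : ‖v‖ = 1) (hz : ‖z‖ = 1)
    (hxv : x ≠ v) (hzv : z ≠ v) : vangle x v z = |posArc v x - posArc v z| / 2 := by
  have key : ∀ y : ℂ, ‖y‖ = 1 → y = v * exp (posArc v y * I) := by
    intro y hy
    have hv0 := ne_zero_circle hv
    have h1 : ‖y / v‖ = 1 := by rw [norm_div, hy, hv]; simp
    have h2 := Complex.norm_mul_exp_arg_mul_I (y / v)
    rw [h1] at h2
    have h3 : exp (posArc v y * I) = y / v := by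
      unfold posArc
      split_ifs
      · simpa using h2
      · push_cast
        rw [add_mul, Complex.exp_add, Complex.exp_two_pi_mul_I]
        simpa using h2
    rw [h3]; field_simp
  have e1 : ∀ y : ℂ, ‖y‖ = 1 → y - v =
      v * exp ((posArc v y / 2 : ℝ) * I) * (2 * I) * (Real.sin (posArc v y / 2) : ℂ) := by
    intro y hy
    conv_lhs => rw [key y hy]
    have : exp (posArc v y * I) = exp ((posArc v y / 2 : ℝ) * I) * exp ((posArc v y / 2 : ℝ) * I) := by
      rw [← Complex.exp_add]; congr 1; push_cast; ring
    rw [this, Complex.ofReal_sin, Complex.sin]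
    have h3 : exp ((posArc v y / 2 : ℝ) * I) * exp (-(posArc v y / 2 : ℝ) * I) = 1 := by
      rw [← Complex.exp_add]; simp
    generalize exp ((posArc v y / 2 : ℝ) * I) = A at *
    generalize exp (-(posArc v y / 2 : ℝ) * I) = B at *
    have hI : I * I = -1 := Complex.I_mul_I
    linear_combination v * h3 + v * A * (A - B) * hI
  have hpx := posArc_pos hv hx
  have hpz := posArc_pos hv hz
  have hlx := posArc_lt hv hx hxv.symm
  have hlz := posArc_lt hv hz hzv.symm
  have sx : 0 < Real.sin (posArc v x / 2) := Real.sin_pos_of_pos_of_lt_pi (by linarith) (by linarith)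
  have sz : 0 < Real.sin (posArc v z / 2) := Real.sin_pos_of_pos_of_lt_pi (by linarith) (by linarith)
  have e2 : (x - v) / (z - v) = ((Real.sin (posArc v x / 2) / Real.sin (posArc v z / 2) : ℝ) : ℂ) *
      exp (((posArc v x - posArc v z) / 2 : ℝ) * I) := by
    have hzv' : z - v ≠ 0 := sub_ne_zero.mpr hzv
    rw [div_eq_iff hzv', e1 x hx, e1 z hz]
    have : exp ((posArc v x / 2 : ℝ) * I) =
      exp (((posArc v x - posArc v z) / 2 : ℝ) * I) * exp ((posArc v z / 2 : ℝ) * I) := by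
      rw [← Complex.exp_add]; congr 1; push_cast; ring
    rw [this]
    have : (Real.sin (posArc v z / 2) : ℂ) ≠ 0 := by exact_mod_cast sz.ne'
    rw [Complex.ofReal_div (Real.sin _) (Real.sin _)]
    field_simp
  unfold vangle
  rw [e2, Complex.arg_real_mul _ (div_pos sx sz), Complex.arg_exp_mul_I,
    (toIocMod_eq_self Real.two_pi_pos).mpr ⟨by linarith, by linarith⟩, abs_div]
  simp

theorem vangle_left_self (v z : ℂ) : vangle v v z = 0 := by simp [vangle]

theorem vangle_right_self (v z : ℂ) : vangle z v v = 0 := by simp [vangle]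

theorem splits3_of {u v w x : ℂ} (hu : ‖u‖ = 1) (hv : ‖v‖ = 1) (hw : ‖w‖ = 1) (hx : ‖x‖ = 1)
    (huv : u ≠ v) (hwv : w ≠ v) (hxv : x ≠ v) (h1 : posArc v w < posArc v x)
    (h2 : posArc v x < posArc v u) : SplitsAngle3 u v w x := by
  unfold SplitsAngle3
  rw [vangle_eq hu hv hx huv hxv, vangle_eq hx hv hw hxv hwv, vangle_eq hu hv hw huv hwv,
    abs_of_pos (by linarith), abs_of_pos (by linarith), abs_of_pos (by linarith)]
  exact ⟨by linarith, by linarith, by linarith⟩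

theorem of_splits3 {u v w x : ℂ} (hu : ‖u‖ = 1) (hv : ‖v‖ = 1) (hw : ‖w‖ = 1) (hx : ‖x‖ = 1)
    (huv : u ≠ v) (hwv : w ≠ v) (hlt : posArc v w < posArc v u) (h : SplitsAngle3 u v w x) :
    posArc v w < posArc v x ∧ posArc v x < posArc v u := by
  have hxv : x ≠ v := by
    rintro rfl
    have := h.1
    rw [vangle_right_self] at this
    exact lt_irrefl _ this
  unfold SplitsAngle3 at h
  rw [vangle_eq hu hv hx huv hxv, vangle_eq hx hv hw hxv hwv, vangle_eq hu hv hw huv hwv] at h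
  obtain ⟨h1, h2, h3⟩ := h
  rw [abs_of_pos (show 0 < posArc v u - posArc v w by linarith)] at h3
  have h1' : posArc v u ≠ posArc v x := by intro h; rw [h] at h1; simp at h1
  have h2' : posArc v x ≠ posArc v w := by intro h; rw [h] at h2; simp at h2
  rcases lt_or_gt_of_ne h1' with a | a <;> rcases lt_or_gt_of_ne h2' with b | b
  · linarith
  · rw [abs_of_neg (by linarith), abs_of_pos (by linarith)] at h3; linarith
  · rw [abs_of_pos (by linarith), abs_of_neg (by linarith)] at h3; linarith
  · exact ⟨b, a⟩

namespace CyclicPolygon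

variable (P : CyclicPolygon)

theorem next_edge {v : ℂ} (hv : v ∈ P.V) : (v, P.next v) ∈ P.E := by
  have h := (P.outdeg v hv).exists
  unfold next
  rw [dif_pos h]; exact h.choose_spec

theorem prev_edge {v : ℂ} (hv : v ∈ P.V) : (P.prev v, v) ∈ P.E := by
  have h := (P.indeg v hv).exists
  unfold prev
  rw [dif_pos h]; exact h.choose_spec

theorem next_eq {v w : ℂ} (h : (v, w) ∈ P.E) : P.next v = w :=
  (P.outdeg v (P.endmem _ h).1).unique (P.next_edge (P.endmem _ h).1) h

theorem prev_eq {v w : ℂ} (h : (v, w) ∈ P.E) : P.prev w = v :=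
  (P.indeg w (P.endmem _ h).2).unique (P.prev_edge (P.endmem _ h).2) h

theorem next_mem {v : ℂ} (hv : v ∈ P.V) : P.next v ∈ P.V := (P.endmem _ (P.next_edge hv)).2

theorem prev_mem {v : ℂ} (hv : v ∈ P.V) : P.prev v ∈ P.V := (P.endmem _ (P.prev_edge hv)).1

theorem acw' {v : ℂ} (hv : v ∈ P.V) : P.prev v ≠ v ∧ P.next v ≠ v ∧
    posArc v (P.next v) < posArc v (P.prev v) := by
  obtain ⟨h1, h2, h3, h4⟩ := P.acw _ _ _ (P.prev_edge hv) (P.next_edge hv)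
  refine ⟨h1, h2.symm, ?_⟩
  have c1 := P.onCircle _ hv
  have c2 := P.onCircle _ (P.prev_mem hv)
  have c3 := P.onCircle _ (P.next_mem hv)
  have h5 := posArc_lt c2 c3 h3
  have h6 := posArc_le c2 c1
  rw [posArc_base c2 c1 c3, posArc_base c2 c1 c2, posArc_self c2, if_pos h4, if_pos (h4.trans h5)]
  linarith

theorem interior_eq {v : ℂ} (hv : v ∈ P.V) :
    interiorAngle P v = (posArc v (P.prev v) - posArc v (P.next v)) / 2 := by
  obtain ⟨h1, h2, h3⟩ := P.acw' hv
  unfold interiorAngle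
  rw [vangle_eq (P.onCircle _ (P.prev_mem hv)) (P.onCircle _ hv) (P.onCircle _ (P.next_mem hv)) h1 h2,
    abs_of_pos (by linarith)]

theorem splits_iff {u x : ℂ} (hu : u ∈ P.V) (hx : ‖x‖ = 1) (hxu : x ≠ u) :
    SplitsVertexAngle P u x ↔
      posArc u (P.next u) < posArc u x ∧ posArc u x < posArc u (P.prev u) := by
  obtain ⟨h1, h2, h3⟩ := P.acw' hu
  have c1 := P.onCircle _ hu
  have c2 := P.onCircle _ (P.prev_mem hu)
  have c3 := P.onCircle _ (P.next_mem hu)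
  constructor
  · intro h
    exact of_splits3 c2 c1 c3 hx h1 h2 h3 h.2
  · intro h
    exact ⟨hu, splits3_of c2 c1 c3 hx h1 h2 hxu h.1 h.2⟩

theorem sum_fst (f : ℂ → ℝ) : ∑ e ∈ P.E, f e.1 = ∑ v ∈ P.V, f v := by
  refine Finset.sum_nbij Prod.fst (fun e he => (P.endmem e he).1) ?_ ?_ (fun _ _ => rfl)
  · rintro ⟨a, b⟩ he ⟨c, d⟩ hf (rfl : a = c)
    rw [(P.next_eq he).symm.trans (P.next_eq hf)]
  · intro v hv
    exact ⟨_, P.next_edge hv, rfl⟩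

theorem sum_snd (f : ℂ → ℝ) : ∑ e ∈ P.E, f e.2 = ∑ v ∈ P.V, f v := by
  refine Finset.sum_nbij Prod.snd (fun e he => (P.endmem e he).2) ?_ ?_ (fun _ _ => rfl)
  · rintro ⟨a, b⟩ he ⟨c, d⟩ hf (rfl : b = d)
    rw [(P.prev_eq he).symm.trans (P.prev_eq hf)]
  · intro v hv
    exact ⟨_, P.prev_edge hv, rfl⟩

theorem sum_next (g : ℂ × ℂ → ℝ) : ∑ e ∈ P.E, g e = ∑ v ∈ P.V, g (v, P.next v) := by
  rw [← P.sum_fst]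
  refine Finset.sum_congr rfl fun e he => ?_
  rw [P.next_eq (v := e.1) (w := e.2) he]

theorem sum_prev (g : ℂ × ℂ → ℝ) : ∑ e ∈ P.E, g e = ∑ v ∈ P.V, g (P.prev v, v) := by
  rw [← P.sum_snd (fun v => g (P.prev v, v))]
  refine Finset.sum_congr rfl fun e he => ?_
  rw [P.prev_eq (v := e.1) (w := e.2) he]

theorem sum_interior :
    ∑ v ∈ P.V, interiorAngle P v = ∑ e ∈ P.E, (Real.pi - posArc e.1 e.2) := by
  have h1 := P.sum_next (fun e => (Real.pi - posArc e.1 e.2) / 2)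
  have h2 := P.sum_prev (fun e => (Real.pi - posArc e.1 e.2) / 2)
  have h3 : ∑ e ∈ P.E, (Real.pi - posArc e.1 e.2) = ∑ e ∈ P.E, (Real.pi - posArc e.1 e.2) / 2
      + ∑ e ∈ P.E, (Real.pi - posArc e.1 e.2) / 2 := by
    rw [← Finset.sum_add_distrib]
    exact Finset.sum_congr rfl fun _ _ => by ring
  rw [h3]
  nth_rewrite 1 [h1]
  rw [h2, ← Finset.sum_add_distrib]
  refine Finset.sum_congr rfl fun v hv => ?_
  rw [P.interior_eq hv]
  have := posArc_add (P.onCircle _ hv) (P.onCircle _ (P.prev_mem hv)) (P.acw' hv).1.symm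
  simp only
  linarith

end CyclicPolygon

theorem rank_injOn {A : Finset ℂ} {f : ℂ → ℝ} (hf : Set.InjOn f A) :
    Set.InjOn (fun v => (A.filter fun z => f z < f v).card) A := by
  have key : ∀ a ∈ A, ∀ b ∈ A, f a < f b →
      (A.filter fun z => f z < f a).card < (A.filter fun z => f z < f b).card := by
    intro a ha b hb h
    apply Finset.card_lt_card
    rw [Finset.ssubset_iff_of_subset]
    · exact ⟨a, by simp [ha, h], by simp⟩
    · intro z hz
      simp only [Finset.mem_filter] at hz ⊢
      exact ⟨hz.1, hz.2.trans h⟩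
  intro a ha b hb h
  by_contra hne
  rcases lt_or_gt_of_ne (fun h' => hne (hf ha hb h')) with h1 | h1
  · exact (key a ha b hb h1).ne h
  · exact (key b hb a ha h1).ne' h

theorem rank_surj {A : Finset ℂ} {f : ℂ → ℝ} (hf : Set.InjOn f A) {k : ℕ} (hk : k < A.card) :
    ∃ s ∈ A, (A.filter fun z => f z < f s).card = k := by
  have h := Finset.surjOn_of_injOn_of_card_le (s := A) (t := Finset.range A.card)
    (fun v => (A.filter fun z => f z < f v).card) ?_ (rank_injOn hf) (by simp)
  · obtain ⟨s, hs, hs'⟩ := h (show k ∈ (Finset.range A.card : Set ℕ) by simpa using hk)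
    exact ⟨s, hs, hs'⟩
  · intro v hv
    simp only [Finset.coe_range, Set.mem_Iio]
    apply Finset.card_lt_card
    rw [Finset.ssubset_iff_of_subset (Finset.filter_subset _ _)]
    exact ⟨v, hv, by simp⟩

theorem rank_count {A : Finset ℂ} {f : ℂ → ℝ} (hf : Set.InjOn f A) {k : ℕ} (hk : k ≤ A.card) :
    k ≤ (A.filter fun v => (A.filter fun z => f z < f v).card < k).card := by
  have := Finset.card_le_card_of_surjOn (s := A.filter fun v => (A.filter fun z => f z < f v).card < k)
    (t := Finset.range k) (fun v => (A.filter fun z => f z < f v).card) ?_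
  · simpa using this
  · intro i hi
    simp only [Finset.coe_range, Set.mem_Iio] at hi
    obtain ⟨s, hs, hs'⟩ := rank_surj hf (hi.trans_le hk)
    refine ⟨s, ?_, hs'⟩
    simp only [Finset.coe_filter, Set.mem_ofPred_eq]
    exact ⟨hs, by omega⟩

/-- Number of vertices of `A` strictly before `v` when starting from just after `u`. -/
def rk (A : Finset ℂ) (u v : ℂ) : ℕ := (A.filter fun z => posArc u z < posArc u v).card

namespace CyclicPolygon

variable {S : CyclicPolygon} {k : ℕ}

theorem posArc_injOn (S : CyclicPolygon) {w : ℂ} (hw : ‖w‖ = 1) : Set.InjOn (posArc w) S.V :=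
  fun _ ha _ hb h => posArc_inj hw (S.onCircle _ ha) (S.onCircle _ hb) h

theorem rk_edge (hS : IsKStar S k) {u v : ℂ} (h : (u, v) ∈ S.E) : rk S.V u v + 1 = k := by
  rw [← hS.2 _ h, edgeLength, rk, ← Set.ncard_coe_finset]
  congr 2
  have hu := S.onCircle _ (S.endmem _ h).1
  have hv := S.onCircle _ (S.endmem _ h).2
  ext z
  simp only [Finset.coe_filter, Set.mem_ofPred_eq, Set.mem_inter_iff, arcOO, Finset.mem_coe]
  constructor
  · rintro ⟨h1, h2⟩
    refine ⟨h1, ?_, ?_, h2⟩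
    · rintro rfl
      rw [posArc_self hu] at h2
      exact absurd (posArc_le hu hv) (not_le.mpr h2)
    · rintro rfl; exact lt_irrefl _ h2
  · rintro ⟨h1, -, -, h2⟩; exact ⟨h1, h2⟩

/-- Counting on the two sides of the chord `s w`. -/
theorem rk_compl (S : CyclicPolygon) {w s : ℂ} (hw : ‖w‖ = 1) (hs : s ∈ S.V) (hne : w ≠ s) :
    rk S.V w s + 1 + (S.V.filter fun z => posArc s z ≤ posArc s w).card = S.V.card := by
  have hs' := S.onCircle _ hs
  have h1 : (S.V.filter fun z => posArc w z ≤ posArc w s).card = rk S.V w s + 1 := by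
    have : (S.V.filter fun z => posArc w z ≤ posArc w s) =
        insert s (S.V.filter fun z => posArc w z < posArc w s) := by
      ext z
      simp only [Finset.mem_filter, Finset.mem_insert]
      constructor
      · rintro ⟨h1, h2⟩
        rcases h2.lt_or_eq with h | h
        · exact Or.inr ⟨h1, h⟩
        · exact Or.inl (S.posArc_injOn hw h1 hs h)
      · rintro (rfl | h)
        · exact ⟨hs, le_rfl⟩
        · exact ⟨h.1, h.2.le⟩
    rw [this, Finset.card_insert_of_notMem (by simp)]; rfl
  rw [← h1, ← Finset.card_filter_add_card_filter_not (s := S.V) (fun z => posArc w z ≤ posArc w s)]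
  congr 2
  ext z
  simp only [Finset.mem_filter]
  refine and_congr_right fun hz => ?_
  have hz' := S.onCircle _ hz
  rw [posArc_base hw hs' hz', posArc_base hw hs' hw, posArc_self hw, if_pos (posArc_lt hw hs' hne)]
  have e1 := posArc_pos hw hz'
  have e2 := posArc_le hw hz'
  split_ifs with h
  · constructor
    · intro; linarith
    · intro; linarith
  · constructor
    · intro; linarith
    · intro; linarith

theorem rk_next (hS : IsKStar S k) {s : ℂ} (hs : s ∈ S.V) : rk S.V s (S.next s) + 1 = k :=
  rk_edge hS (S.next_edge hs)

theorem rk_prev_le (hS : IsKStar S k) {s : ℂ} (hs : s ∈ S.V) :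
    (S.V.filter fun z => posArc s z ≤ posArc s (S.prev s)).card = k + 1 := by
  have h1 := rk_edge hS (S.prev_edge hs)
  have h2 := rk_compl S (S.onCircle _ (S.prev_mem hs)) hs (S.acw' hs).1
  have h3 := hS.1
  omega

theorem rk_lt_of_lt (S : CyclicPolygon) {w a b : ℂ} (ha : a ∈ S.V) (h : posArc w a < posArc w b) :
    rk S.V w a < rk S.V w b := by
  apply Finset.card_lt_card
  rw [Finset.ssubset_iff_of_subset]
  · exact ⟨a, by simp [ha, h], by simp⟩
  · intro z hz
    simp only [Finset.mem_filter] at hz ⊢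
    exact ⟨hz.1, hz.2.trans h⟩

theorem card_le_eq (S : CyclicPolygon) {w s : ℂ} (hw : ‖w‖ = 1) (hs : s ∈ S.V) :
    (S.V.filter fun z => posArc w z ≤ posArc w s).card = rk S.V w s + 1 := by
  have : (S.V.filter fun z => posArc w z ≤ posArc w s) =
      insert s (S.V.filter fun z => posArc w z < posArc w s) := by
    ext z
    simp only [Finset.mem_filter, Finset.mem_insert]
    constructor
    · rintro ⟨h1, h2⟩
      rcases h2.lt_or_eq with h | h
      · exact Or.inr ⟨h1, h⟩
      · exact Or.inl (S.posArc_injOn hw h1 hs h)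
    · rintro (rfl | h)
      · exact ⟨hs, le_rfl⟩
      · exact ⟨h.1, h.2.le⟩
  rw [this, Finset.card_insert_of_notMem (by simp)]; rfl

theorem rk_prev (hS : IsKStar S k) {s : ℂ} (hs : s ∈ S.V) : rk S.V s (S.prev s) = k := by
  have h1 := rk_prev_le hS hs
  have h2 := card_le_eq S (S.onCircle _ hs) (S.prev_mem hs)
  omega

theorem rk_self (hS : IsKStar S k) {s : ℂ} (hs : s ∈ S.V) : rk S.V s s = 2 * k := by
  have h2 := card_le_eq S (S.onCircle _ hs) hs
  have : (S.V.filter fun z => posArc s z ≤ posArc s s) = S.V := by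
    apply Finset.filter_true_of_mem
    intro z hz
    rw [posArc_self (S.onCircle _ hs)]
    exact posArc_le (S.onCircle _ hs) (S.onCircle _ hz)
  rw [this, hS.1] at h2
  omega

theorem med_ne (hk : 0 < k) (hS : IsKStar S k) {w s : ℂ} (hs : s ∈ S.V) (h : rk S.V w s = k) :
    w ≠ s := by
  rintro rfl
  have := rk_self hS hs
  omega

theorem med_interval (hk : 0 < k) (hS : IsKStar S k) {w s : ℂ} (hw : ‖w‖ = 1) (hs : s ∈ S.V)
    (h : rk S.V w s = k) :
    posArc s (S.next s) ≤ posArc s w ∧ posArc s w < posArc s (S.prev s) := by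
  have h1 := rk_compl S hw hs (med_ne hk hS hs h)
  have h2 := hS.1
  have h3 := rk_next hS hs
  have h4 := rk_prev_le hS hs
  constructor
  · by_contra hc
    have : (S.V.filter fun z => posArc s z ≤ posArc s w).card ≤ rk S.V s (S.next s) := by
      apply Finset.card_le_card
      intro z hz
      simp only [Finset.mem_filter] at hz ⊢
      exact ⟨hz.1, by linarith⟩
    omega
  · by_contra hc
    have : (S.V.filter fun z => posArc s z ≤ posArc s (S.prev s)).card ≤
        (S.V.filter fun z => posArc s z ≤ posArc s w).card := by
      apply Finset.card_le_card
      intro z hz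
      simp only [Finset.mem_filter] at hz ⊢
      exact ⟨hz.1, by linarith⟩
    omega

theorem med_exists (hS : IsKStar S k) {w : ℂ} (hw : ‖w‖ = 1) : ∃ s ∈ S.V, rk S.V w s = k :=
  rank_surj (S.posArc_injOn hw) (by rw [hS.1]; omega)

theorem med_unique (S : CyclicPolygon) {w a b : ℂ} (hw : ‖w‖ = 1) (ha : a ∈ S.V) (hb : b ∈ S.V)
    (h : rk S.V w a = rk S.V w b) : a = b :=
  rank_injOn (S.posArc_injOn hw) ha hb h

/-- Moving the base point from `w` to `w'` without passing over vertices. -/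
theorem med_move {w w' s : ℂ} (hw : ‖w‖ = 1) (hw' : ‖w'‖ = 1) (hs : s ∈ S.V)
    (hgap : ∀ z ∈ S.V, ¬ posArc w z < posArc w w') (hn : w' ∉ S.V) :
    rk S.V w' s = rk S.V w s := by
  unfold rk
  congr 1
  apply Finset.filter_congr
  intro z hz
  have key : ∀ y ∈ S.V, posArc w' y = posArc w y - posArc w w' := by
    intro y hy
    have : posArc w w' < posArc w y := by
      refine lt_of_le_of_ne (not_lt.mp (hgap y hy)) fun h => hn ?_
      rw [posArc_inj hw hw' (S.onCircle _ hy) h]; exact hy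
    rw [posArc_base hw hw' (S.onCircle _ hy), if_pos this]
  rw [key z hz, key s hs]
  constructor <;> intro <;> linarith

/-- Moving the base point from `w` to a vertex `w'`. -/
theorem med_move_mem (hS : IsKStar S k) {w w' : ℂ} (hw : ‖w‖ = 1) (hw' : w' ∈ S.V)
    (hgap : ∀ z ∈ S.V, ¬ posArc w z < posArc w w') :
    rk S.V w (S.next w') = k := by
  have c := S.onCircle _ hw'
  have key : ∀ y ∈ S.V, y ≠ w' → posArc w w' < posArc w y ∧
      posArc w' y = posArc w y - posArc w w' := by
    intro y hy hne
    have : posArc w w' < posArc w y := by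
      refine lt_of_le_of_ne (not_lt.mp (hgap y hy)) fun h => hne ?_
      exact (posArc_inj hw c (S.onCircle _ hy) h).symm
    exact ⟨this, by rw [posArc_base hw c (S.onCircle _ hy), if_pos this]⟩
  obtain ⟨k1, k2⟩ := key _ (S.next_mem hw') (S.acw' hw').2.1
  have h1 := rk_next hS hw'
  rw [← h1]
  have : (S.V.filter fun z => posArc w z < posArc w (S.next w')) =
      insert w' (S.V.filter fun z => posArc w' z < posArc w' (S.next w')) := by
    ext z
    simp only [Finset.mem_filter, Finset.mem_insert]
    by_cases hz : z = w'
    · subst hz; simp [hw', k1]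
    · simp only [hz, false_or]
      refine and_congr_right fun hzm => ?_
      rw [k2, (key z hzm hz).2]
      constructor <;> intro <;> linarith
  unfold rk
  rw [this, Finset.card_insert_of_notMem]
  simp only [Finset.mem_filter, not_and, not_lt]
  intro _
  rw [posArc_self c]
  exact posArc_le c (S.onCircle _ (S.next_mem hw'))

/-- The interior angles of a star add up to at most `π`. -/
theorem star_sum (hS : IsKStar S k) : ∑ v ∈ S.V, interiorAngle S v ≤ Real.pi := by
  have hc : (∑ e ∈ S.E, (1 : ℝ)) = 2 * k + 1 := by
    rw [S.sum_fst (fun _ => 1)]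
    simp [hS.1]
  have h1 : ∑ e ∈ S.E, posArc e.1 e.2 =
      ∑ e ∈ S.E, (if arg e.1 < arg e.2 then (0 : ℝ) else 2 * Real.pi) := by
    have h2 : ∑ e ∈ S.E, posArc e.1 e.2 = ∑ e ∈ S.E, (arg e.2 - arg e.1 +
        (if arg e.1 < arg e.2 then (0 : ℝ) else 2 * Real.pi)) := by
      refine Finset.sum_congr rfl fun e he => ?_
      rw [posArc_arg (S.onCircle _ (S.endmem e he).1) (S.onCircle _ (S.endmem e he).2)]
      split_ifs <;> ring
    rw [h2, Finset.sum_add_distrib, Finset.sum_sub_distrib, S.sum_fst, S.sum_snd]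
    ring
  have h2 : (k : ℝ) * (2 * Real.pi) ≤
      ∑ e ∈ S.E, (if arg e.1 < arg e.2 then (0 : ℝ) else 2 * Real.pi) := by
    rw [S.sum_next]
    simp only
    have hinj : Set.InjOn (fun z => - arg z) (S.V : Set ℂ) := by
      intro a ha b hb h
      exact arg_inj_circle (S.onCircle _ ha) (S.onCircle _ hb) (neg_injective h)
    have hcount := rank_count hinj (k := k) (by rw [hS.1]; omega)
    set B := S.V.filter fun v => (S.V.filter fun z => - arg z < - arg v).card < k with hB
    calc (k : ℝ) * (2 * Real.pi) ≤ B.card * (2 * Real.pi) := by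
          have : (k : ℝ) ≤ B.card := by exact_mod_cast hcount
          nlinarith [Real.pi_pos]
      _ = ∑ v ∈ B, (2 * Real.pi) := by simp
      _ = ∑ v ∈ B, (if arg v < arg (S.next v) then (0 : ℝ) else 2 * Real.pi) := by
          refine Finset.sum_congr rfl fun v hv => ?_
          rw [if_neg]
          intro hlt
          rw [hB, Finset.mem_filter] at hv
          have c := S.onCircle _ hv.1
          have h3 := card_le_eq S c (S.next_mem hv.1)
          have h4 := rk_next hS hv.1
          have h5 : (S.V.filter fun z => posArc v z ≤ posArc v (S.next v)).card ≤
              (S.V.filter fun z => - arg z < - arg v).card := by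
            apply Finset.card_le_card
            intro z hz
            simp only [Finset.mem_filter] at hz ⊢
            refine ⟨hz.1, ?_⟩
            have h6 := hz.2
            rw [posArc_arg c (S.onCircle _ hz.1), posArc_arg c (S.onCircle _ (S.next_mem hv.1)),
              if_pos hlt] at h6
            have := Complex.neg_pi_lt_arg z
            have := Complex.arg_le_pi (S.next v)
            split_ifs at h6 <;> linarith
          omega
      _ ≤ _ := by
          apply Finset.sum_le_sum_of_subset_of_nonneg (Finset.filter_subset _ _)
          intro i _ _
          split_ifs <;> linarith [Real.pi_pos]
  rw [S.sum_interior, Finset.sum_sub_distrib, h1]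
  have : ∑ e ∈ S.E, Real.pi = (2 * k + 1) * Real.pi := by
    rw [← hc, Finset.sum_mul]; simp
  rw [this]
  linarith

end CyclicPolygon

namespace CyclicPolygon

/-- Angles of `S` and `T` at common vertices have disjoint interiors. -/
def NoOverlap (S T : CyclicPolygon) : Prop :=
  ∀ y, y ∈ S.V → y ∈ T.V → posArc y (S.prev y) ≤ posArc y (T.next y) ∨
    posArc y (T.prev y) ≤ posArc y (S.next y)

theorem NoOverlap.symm {S T : CyclicPolygon} (h : NoOverlap S T) : NoOverlap T S :=
  fun y h1 h2 => (h y h2 h1).symm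

/-- Just after `w`, the bisector of `S` is beyond the bisector of `T`. -/
def Good (S T : CyclicPolygon) (k l : ℕ) (w : ℂ) : Prop :=
  ∃ s ∈ S.V, ∃ t ∈ T.V, rk S.V w s = k ∧ rk T.V w t = l ∧ posArc w t < posArc w s

theorem good_or_bad {S T : CyclicPolygon} {k l : ℕ} (hk : 0 < k) (hl : 0 < l)
    (hS : IsKStar S k) (hT : IsKStar T l) (hno : NoOverlap S T) {w : ℂ} (hw : ‖w‖ = 1) :
    Good S T k l w ∨ Good T S l k w := by
  obtain ⟨s, hs, hs'⟩ := med_exists hS hw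
  obtain ⟨t, ht, ht'⟩ := med_exists hT hw
  rcases lt_trichotomy (posArc w t) (posArc w s) with h | h | h
  · exact Or.inl ⟨s, hs, t, ht, hs', ht', h⟩
  · exfalso
    have := posArc_inj hw (T.onCircle _ ht) (S.onCircle _ hs) h
    subst this
    have h1 := med_interval hk hS hw hs hs'
    have h2 := med_interval hl hT hw ht ht'
    rcases hno t hs ht with h3 | h3 <;> linarith
  · exact Or.inr ⟨t, ht, s, hs, ht', hs', h⟩

theorem good_flip {S T : CyclicPolygon} {k l : ℕ} (hl : 0 < l)
    (hS : IsKStar S k) (hT : IsKStar T l) {w : ℂ} (hw : ‖w‖ = 1)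
    (h : Good S T k l w) : ∃ t ∈ T.V, Good T S l k t := by
  obtain ⟨s, hs, t, ht, hs', ht', hlt⟩ := h
  refine ⟨t, ht, ?_⟩
  have ct := T.onCircle _ ht
  have hne := med_ne hl hT ht ht'
  obtain ⟨s₁, hs₁, hs₁'⟩ := med_exists hS ct
  obtain ⟨t₁, ht₁, ht₁'⟩ := med_exists hT ct
  refine ⟨t₁, ht₁, s₁, hs₁, ht₁', hs₁', ?_⟩
  have hA : posArc t w < posArc t t₁ := by
    by_contra hc
    have h1 := rk_compl T hw ht hne
    have h2 := card_le_eq T ct ht₁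
    have h3 : (T.V.filter fun z => posArc t z ≤ posArc t t₁).card ≤
        (T.V.filter fun z => posArc t z ≤ posArc t w).card := by
      apply Finset.card_le_card
      intro z hz
      simp only [Finset.mem_filter] at hz ⊢
      exact ⟨hz.1, by linarith⟩
    have := hT.1
    omega
  have hB : posArc t s₁ ≤ posArc t w := by
    by_contra hc
    -- vertices of `S` in `(t, w]` are few, so those in `(w, t]` are many
    have h1 : (S.V.filter fun z => posArc t z ≤ posArc t w).card ≤ rk S.V t s₁ := by
      apply Finset.card_le_card
      intro z hz
      simp only [Finset.mem_filter] at hz ⊢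
      exact ⟨hz.1, by linarith⟩
    have h2 : (S.V.filter fun z => ¬ posArc t z ≤ posArc t w).card ≤ rk S.V w s := by
      apply Finset.card_le_card
      intro z hz
      simp only [Finset.mem_filter] at hz ⊢
      refine ⟨hz.1, ?_⟩
      have cz := S.onCircle _ hz.1
      have h3 := hz.2
      rw [posArc_base hw ct cz, posArc_base hw ct hw, posArc_self hw,
        if_pos (posArc_lt hw ct hne)] at h3
      have := posArc_le hw cz
      split_ifs at h3 with h4
      · exact absurd (by linarith) h3
      · linarith
    have h3 := Finset.card_filter_add_card_filter_not (s := S.V)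
      (fun z => posArc t z ≤ posArc t w)
    have := hS.1
    omega
  linarith

theorem common_bisector {S T : CyclicPolygon} {k l : ℕ} (hk : 0 < k) (hl : 0 < l)
    (hS : IsKStar S k) (hT : IsKStar T l) (hno : NoOverlap S T) :
    ∃ u ∈ S.V, ∃ v ∈ T.V, u ≠ v ∧
      (posArc u (S.next u) < posArc u v ∧ posArc u v < posArc u (S.prev u)) ∧
      (posArc v (T.next v) < posArc v u ∧ posArc v u < posArc v (T.prev v)) := by
  set W := S.V ∪ T.V with hW
  have cW : ∀ w ∈ W, ‖w‖ = 1 := by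
    intro w hw
    rcases Finset.mem_union.mp hw with h | h
    · exact S.onCircle _ h
    · exact T.onCircle _ h
  have ex : ∃ q ∈ W ×ˢ W, Good S T k l q.1 ∧ Good T S l k q.2 := by
    obtain ⟨w, hw⟩ := S.nonempty
    have cw := S.onCircle _ hw
    rcases good_or_bad hk hl hS hT hno cw with h | h
    · obtain ⟨t, ht, ht'⟩ := good_flip hl hS hT cw h
      exact ⟨(w, t), by simp [hW, hw, ht], h, ht'⟩
    · obtain ⟨t, ht, ht'⟩ := good_flip hk hT hS cw h
      exact ⟨(t, w), by simp [hW, hw, ht], ht', h⟩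
  obtain ⟨q, hq, hmin⟩ := Finset.exists_min_image
    ((W ×ˢ W).filter fun q => Good S T k l q.1 ∧ Good T S l k q.2) (fun q => posArc q.1 q.2)
    (by obtain ⟨q, hq, h⟩ := ex; exact ⟨q, Finset.mem_filter.mpr ⟨hq, h⟩⟩)
  obtain ⟨w, p⟩ := q
  simp only [Finset.mem_filter, Finset.mem_product] at hq hmin
  obtain ⟨⟨hwW, hpW⟩, hg, hb⟩ := hq
  have cw := cW _ hwW
  have cp := cW _ hpW
  have hgap : ∀ z ∈ W, ¬ posArc w z < posArc w p := by
    intro z hz hlt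
    have cz := cW _ hz
    rcases good_or_bad hk hl hS hT hno cz with h | h
    · have h1 := hmin (z, p) ⟨⟨hz, hpW⟩, h, hb⟩
      simp only at h1
      rw [posArc_base cw cz cp, if_pos hlt] at h1
      have := posArc_pos cw cz
      linarith
    · have h1 := hmin (w, z) ⟨⟨hwW, hz⟩, hg, h⟩
      simp only at h1
      linarith
  have gS : ∀ z ∈ S.V, ¬ posArc w z < posArc w p := fun z hz => hgap z (by simp [hW, hz])
  have gT : ∀ z ∈ T.V, ¬ posArc w z < posArc w p := fun z hz => hgap z (by simp [hW, hz])
  have shift : ∀ y ∈ W, y ≠ p → posArc p y = posArc w y - posArc w p := by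
    intro y hy hne
    have : posArc w p < posArc w y := by
      refine lt_of_le_of_ne (not_lt.mp (hgap y hy)) fun h => hne ?_
      exact (posArc_inj cw cp (cW _ hy) h).symm
    rw [posArc_base cw cp (cW _ hy), if_pos this]
  obtain ⟨s, hs, t, ht, hs1, ht1, hst⟩ := hg
  obtain ⟨t', ht', s', hs', ht2, hs2, hst'⟩ := hb
  have sW : s ∈ W := by simp [hW, hs]
  have tW : t ∈ W := by simp [hW, ht]
  by_cases hpS : p ∈ S.V
  · exfalso
    have e1 : s = S.next p := med_unique S cw hs (S.next_mem hpS)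
      (hs1.trans (med_move_mem hS cw hpS gS).symm)
    have e2 : s' = S.prev p := med_unique S cp hs' (S.prev_mem hpS)
      (hs2.trans (rk_prev hS hpS).symm)
    obtain ⟨n1, n2, n3⟩ := S.acw' hpS
    rw [← e1] at n2 n3
    rw [← e2] at n1 n3
    have f1 := shift s sW n2
    by_cases hpT : p ∈ T.V
    · have e3 : t = T.next p := med_unique T cw ht (T.next_mem hpT)
        (ht1.trans (med_move_mem hT cw hpT gT).symm)
      have e4 : t' = T.prev p := med_unique T cp ht' (T.prev_mem hpT)
        (ht2.trans (rk_prev hT hpT).symm)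
      obtain ⟨m1, m2, m3⟩ := T.acw' hpT
      rw [← e3] at m2
      have f2 := shift t tW m2
      have := hno p hpS hpT
      rw [← e1, ← e2, ← e3, ← e4] at this
      rcases this with h | h <;> linarith
    · have e3 : t' = t := med_unique T cp ht' ht
        (by rw [ht2, med_move cw cp ht gT hpT, ht1])
      subst e3
      have f2 := shift t' tW (by rintro rfl; exact hpT ht)
      linarith
  · have e1 : s' = s := med_unique S cp hs' hs
        (by rw [hs2, med_move cw cp hs gS hpS, hs1])
    subst e1
    have nsp : s' ≠ p := by rintro rfl; exact hpS hs
    have f1 := shift s' sW nsp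
    by_cases hpT : p ∈ T.V
    · have e3 : t = T.next p := med_unique T cw ht (T.next_mem hpT)
        (ht1.trans (med_move_mem hT cw hpT gT).symm)
      have e4 : t' = T.prev p := med_unique T cp ht' (T.prev_mem hpT)
        (ht2.trans (rk_prev hT hpT).symm)
      obtain ⟨m1, m2, m3⟩ := T.acw' hpT
      rw [← e3] at m2
      have f2 := shift t tW m2
      obtain ⟨i1, i2⟩ := med_interval hk hS cp hs hs2
      refine ⟨s', hs, p, hpT, nsp, ⟨lt_of_le_of_ne i1 fun h => hpS ?_, i2⟩, ?_, ?_⟩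
      · rw [← posArc_inj (S.onCircle _ hs) (S.onCircle _ (S.next_mem hs)) cp h]
        exact S.next_mem hs
      · rw [← e3]; linarith
      · rw [← e4]; exact hst'
    · exfalso
      have e3 : t' = t := med_unique T cp ht' ht
        (by rw [ht2, med_move cw cp ht gT hpT, ht1])
      subst e3
      have f2 := shift t' tW (by rintro rfl; exact hpT ht)
      linarith

section Decomp

variable {P : CyclicPolygon} {D : Set (Sym2 ℂ)} {𝒮 : Finset CyclicPolygon}

theorem linkable_arc {u v : ℂ} (h : Linkable P u v) :
    u ∈ P.V ∧ v ∈ P.V ∧ u ≠ v ∧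
    (posArc u (P.next u) < posArc u v ∧ posArc u v < posArc u (P.prev u)) ∧
    (posArc v (P.next v) < posArc v u ∧ posArc v u < posArc v (P.prev v)) := by
  obtain ⟨h1, h2, h3⟩ := h
  have hu := h2.1
  have hv := h3.1
  exact ⟨hu, hv, h1, (P.splits_iff hu (P.onCircle _ hv) h1.symm).mp h2,
    (P.splits_iff hv (P.onCircle _ hu) h1).mp h3⟩

theorem arc_linkable {u v : ℂ} (hu : u ∈ P.V) (hv : v ∈ P.V) (h1 : u ≠ v)
    (h2 : posArc u (P.next u) < posArc u v ∧ posArc u v < posArc u (P.prev u))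
    (h3 : posArc v (P.next v) < posArc v u ∧ posArc v u < posArc v (P.prev v)) :
    Linkable P u v :=
  ⟨h1, (P.splits_iff hu (P.onCircle _ hv) h1.symm).mpr h2,
    (P.splits_iff hv (P.onCircle _ hu) h1).mpr h3⟩

theorem dec_in (h : IsStarDecomp P D 𝒮) {S : CyclicPolygon} (hS : S ∈ 𝒮) {u : ℂ} (hu : u ∈ S.V) :
    S.prev u = P.prev u ∨ (s(u, S.prev u) ∈ D ∧ posArc u (S.prev u) < posArc u (P.prev u)) := by
  rcases h.2.2.1 S hS (S.prev_edge hu) with h1 | h1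
  · exact Or.inl (P.prev_eq h1).symm
  · have h2 : s(S.prev u, u) ∈ D := h1
    rw [Sym2.eq_swap] at h2
    exact Or.inr ⟨h2, (linkable_arc (h.1 _ _ h2)).2.2.2.1.2⟩

theorem dec_out (h : IsStarDecomp P D 𝒮) {S : CyclicPolygon} (hS : S ∈ 𝒮) {u : ℂ} (hu : u ∈ S.V) :
    posArc u (P.next u) ≤ posArc u (S.next u) := by
  rcases h.2.2.1 S hS (S.next_edge hu) with h1 | h1
  · rw [P.next_eq h1]
  · have h2 : s(u, S.next u) ∈ D := h1
    exact (linkable_arc (h.1 _ _ h2)).2.2.2.1.1.le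

theorem dec_aux (h : IsStarDecomp P D 𝒮) {S T : CyclicPolygon} (hS : S ∈ 𝒮) (hT : T ∈ 𝒮) {y : ℂ}
    (hyS : y ∈ S.V) (hyT : y ∈ T.V) (hlt : posArc y (S.prev y) < posArc y (T.prev y)) :
    posArc y (S.prev y) ≤ posArc y (T.next y) := by
  by_contra hc
  push Not at hc
  rcases dec_in h hS hyS with h1 | ⟨h1, -⟩
  · rw [h1] at hlt
    rcases dec_in h hT hyT with h2 | ⟨-, h2⟩
    · rw [h2] at hlt; exact lt_irrefl _ hlt
    · linarith
  · refine h.2.2.2.2.2 T hT _ _ _ (T.prev_edge hyT) (T.next_edge hyT) ⟨S.prev y, h1, ?_⟩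
    obtain ⟨m1, m2, m3⟩ := T.acw' hyT
    exact splits3_of (T.onCircle _ (T.prev_mem hyT)) (T.onCircle _ hyT)
      (T.onCircle _ (T.next_mem hyT)) (S.onCircle _ (S.prev_mem hyS)) m1 m2 (S.acw' hyS).1 hc hlt

theorem dec_noOverlap (h : IsStarDecomp P D 𝒮) {S T : CyclicPolygon} (hS : S ∈ 𝒮) (hT : T ∈ 𝒮)
    (hne : S ≠ T) : NoOverlap S T := by
  intro y hyS hyT
  rcases lt_trichotomy (posArc y (S.prev y)) (posArc y (T.prev y)) with h1 | h1 | h1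
  · exact Or.inl (dec_aux h hS hT hyS hyT h1)
  · exfalso
    have h2 := posArc_inj (S.onCircle _ hyS) (S.onCircle _ (S.prev_mem hyS))
      (T.onCircle _ (T.prev_mem hyT)) h1
    refine h.2.2.2.2.1 S hS T hT hne _ (S.prev_edge hyS) ?_
    rw [h2]; exact T.prev_edge hyT
  · exact Or.inr (dec_aux h hT hS hyT hyS h1)

theorem dec_pair (h : IsStarDecomp P D 𝒮) {S T : CyclicPolygon} (hS : S ∈ 𝒮) (hT : T ∈ 𝒮)
    (hne : S ≠ T) : ∃ q : ℂ × ℂ, Linkable P q.1 q.2 ∧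
      (q.1 ∈ S.V ∧ posArc q.1 (S.next q.1) < posArc q.1 q.2 ∧
        posArc q.1 q.2 < posArc q.1 (S.prev q.1)) ∧
      (q.2 ∈ T.V ∧ posArc q.2 (T.next q.2) < posArc q.2 q.1 ∧
        posArc q.2 q.1 < posArc q.2 (T.prev q.2)) := by
  obtain ⟨⟨k, hk, hSk⟩, sS⟩ := h.2.1 S hS
  obtain ⟨⟨l, hl, hTl⟩, sT⟩ := h.2.1 T hT
  obtain ⟨u, hu, v, hv, huv, h1, h2⟩ := common_bisector hk hl hSk hTl (dec_noOverlap h hS hT hne)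
  have prevle : ∀ {R : CyclicPolygon} (_ : R ∈ 𝒮) {x : ℂ} (_ : x ∈ R.V),
      posArc x (R.prev x) ≤ posArc x (P.prev x) := by
    intro R hR x hx
    rcases dec_in h hR hx with h3 | h3
    · rw [h3]
    · exact h3.2.le
  refine ⟨(u, v), arc_linkable (sS hu) (sT hv) huv ?_ ?_, ⟨hu, h1⟩, ⟨hv, h2⟩⟩
  · exact ⟨(dec_out h hS hu).trans_lt h1.1, h1.2.trans_le (prevle hS hu)⟩
  · exact ⟨(dec_out h hT hv).trans_lt h2.1, h2.2.trans_le (prevle hT hv)⟩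

theorem dec_eq (h : IsStarDecomp P D 𝒮) {S T : CyclicPolygon} (hS : S ∈ 𝒮) (hT : T ∈ 𝒮) {y x : ℂ}
    (h1 : y ∈ S.V ∧ posArc y (S.next y) < posArc y x ∧ posArc y x < posArc y (S.prev y))
    (h2 : y ∈ T.V ∧ posArc y (T.next y) < posArc y x ∧ posArc y x < posArc y (T.prev y)) :
    S = T := by
  by_contra hne
  rcases dec_noOverlap h hS hT hne y h1.1 h2.1 with h3 | h3 <;> linarith

theorem dec_count (h : IsStarDecomp P D 𝒮) :
    𝒮.card * 𝒮.card - 𝒮.card ≤ {q : ℂ × ℂ | Linkable P q.1 q.2}.ncard := by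
  have hfin : {q : ℂ × ℂ | Linkable P q.1 q.2}.Finite := by
    apply (P.V ×ˢ P.V).finite_toSet.subset
    intro q hq
    have := linkable_arc hq
    simp [this.1, this.2.1]
  rw [← Finset.offDiag_card, ← Set.ncard_coe_finset]
  have hex : ∀ a : CyclicPolygon × CyclicPolygon, ∃ q : ℂ × ℂ, a ∈ 𝒮.offDiag →
      Linkable P q.1 q.2 ∧
      (q.1 ∈ a.1.V ∧ posArc q.1 (a.1.next q.1) < posArc q.1 q.2 ∧
        posArc q.1 q.2 < posArc q.1 (a.1.prev q.1)) ∧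
      (q.2 ∈ a.2.V ∧ posArc q.2 (a.2.next q.2) < posArc q.2 q.1 ∧
        posArc q.2 q.1 < posArc q.2 (a.2.prev q.2)) := by
    intro a
    by_cases ha : a ∈ 𝒮.offDiag
    · have ha' := Finset.mem_offDiag.mp ha
      obtain ⟨q, hq⟩ := dec_pair h ha'.1 ha'.2.1 ha'.2.2
      exact ⟨q, fun _ => hq⟩
    · exact ⟨0, fun h => absurd h ha⟩
  choose f hf using hex
  refine Set.ncard_le_ncard_of_injOn f ?_ ?_ hfin
  · intro a ha
    exact (hf a ha).1
  · intro a ha b hb hab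
    have h1 := hf a ha
    have h2 := hf b hb
    have ha' := Finset.mem_offDiag.mp ha
    have hb' := Finset.mem_offDiag.mp hb
    rw [← hab] at h2
    exact Prod.ext (dec_eq h ha'.1 hb'.1 h1.2.1 h2.2.1) (dec_eq h ha'.2.1 hb'.2.1 h1.2.2 h2.2.2)

theorem dec_sum (h : IsStarDecomp P D 𝒮) :
    ∑ v ∈ P.V, interiorAngle P v ≤ 𝒮.card * Real.pi := by
  set Dt : Finset (ℂ × ℂ) := (P.V ×ˢ P.V).filter fun e => e ∈ tilde D with hDt
  have memDt : ∀ e, e ∈ Dt ↔ e ∈ tilde D := by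
    intro e
    rw [hDt, Finset.mem_filter, and_iff_right_iff_imp]
    intro he
    have := linkable_arc (h.1 e.1 e.2 he)
    simp [this.1, this.2.1]
  have hdisj : Disjoint P.E Dt := by
    rw [Finset.disjoint_left]
    intro e he he'
    have h1 := linkable_arc (h.1 e.1 e.2 ((memDt e).mp he'))
    have h2 := P.prev_eq (v := e.1) (w := e.2) he
    rw [h2] at h1
    exact lt_irrefl _ h1.2.2.2.2.2
  have hun : 𝒮.biUnion (fun S => S.E) = P.E ∪ Dt := by
    ext e
    rw [Finset.mem_biUnion, Finset.mem_union, memDt]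
    constructor
    · rintro ⟨S, hS, he⟩
      exact h.2.2.1 S hS he
    · intro he
      exact h.2.2.2.1 e he
  have hzero : ∑ e ∈ Dt, (Real.pi - posArc e.1 e.2) = 0 := by
    refine Finset.sum_involution (fun e _ => e.swap) ?_ ?_ ?_ ?_
    · intro e he
      obtain ⟨h1, h2, h3, -⟩ := linkable_arc (h.1 e.1 e.2 ((memDt e).mp he))
      have := posArc_add (P.onCircle _ h1) (P.onCircle _ h2) h3
      simp only [Prod.fst_swap, Prod.snd_swap]
      linarith
    · intro e he _ heq
      obtain ⟨h1, h2, h3, -⟩ := linkable_arc (h.1 e.1 e.2 ((memDt e).mp he))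
      exact h3 (congrArg Prod.snd heq)
    · intro e he
      rw [memDt] at he ⊢
      have : s(e.1, e.2) ∈ D := he
      rw [Sym2.eq_swap] at this
      exact this
    · intro e _
      exact Prod.swap_swap e
  calc ∑ v ∈ P.V, interiorAngle P v = ∑ e ∈ P.E, (Real.pi - posArc e.1 e.2) := P.sum_interior
    _ = ∑ e ∈ P.E ∪ Dt, (Real.pi - posArc e.1 e.2) := by
        rw [Finset.sum_union hdisj, hzero, add_zero]
    _ = ∑ S ∈ 𝒮, ∑ e ∈ S.E, (Real.pi - posArc e.1 e.2) := by
        rw [← hun, Finset.sum_biUnion]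
        intro S hS T hT hne
        exact Finset.disjoint_left.mpr fun e he => h.2.2.2.2.1 S hS T hT hne e he
    _ ≤ ∑ S ∈ 𝒮, Real.pi := by
        refine Finset.sum_le_sum fun S hS => ?_
        obtain ⟨⟨k, hk, hSk⟩, sS⟩ := h.2.1 S hS
        rw [← S.sum_interior]
        exact star_sum hSk
    _ = 𝒮.card * Real.pi := by simp

end Decomp

end CyclicPolygon

/-- If a cyclic polygon with `n` vertices, `p` linkable pairs and rotation
number `r` admits a star decomposition, then `p ≥ (n - 2r)(n - 2r - 1)/2`. -/
theorem linkable_pairs_lower_bound (P : CyclicPolygon) (r p : ℕ) (hr : 0 < r)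
    (hrot : ∑ v ∈ P.V, (Real.pi - interiorAngle P v) = 2 * Real.pi * r)
    (hp : {q : ℂ × ℂ | Linkable P q.1 q.2}.ncard = 2 * p)
    (hadmits : ∃ D₀ : Set (Sym2 ℂ), HasStarDecomp P D₀) :
    (p : ℚ) ≥ ((P.V.card : ℚ) - 2 * r) * ((P.V.card : ℚ) - 2 * r - 1) / 2 := by

  obtain ⟨D, 𝒮, h⟩ := hadmits
  have h1 := CyclicPolygon.dec_sum h
  have h2 := CyclicPolygon.dec_count h
  have h3 : 0 ≤ ∑ v ∈ P.V, interiorAngle P v :=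
    Finset.sum_nonneg fun v _ => abs_nonneg _
  rw [Finset.sum_sub_distrib] at hrot
  simp only [Finset.sum_const, nsmul_eq_mul] at hrot
  have hpi := Real.pi_pos
  have h4 : (P.V.card : ℝ) - 2 * r ≤ 𝒮.card := by
    by_contra hc
    push Not at hc
    nlinarith
  have h5 : 0 ≤ (P.V.card : ℝ) - 2 * r := by
    by_contra hc
    push Not at hc
    nlinarith
  have h5' : 2 * r ≤ P.V.card := by
    have : (2 * r : ℝ) ≤ P.V.card := by linarith
    exact_mod_cast this
  obtain ⟨m, hm⟩ := Nat.exists_eq_add_of_le h5'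
  rw [hm] at h4 ⊢
  have h6 : m ≤ 𝒮.card := by
    have : (m : ℝ) ≤ 𝒮.card := by push_cast at h4; linarith
    exact_mod_cast this
  rw [hp] at h2
  have h7 : m * m - m ≤ 2 * p := by
    refine le_trans ?_ h2
    rw [← Nat.mul_sub_one, ← Nat.mul_sub_one]
    exact Nat.mul_le_mul h6 (by omega)
  have h8 : m * m ≤ 2 * p + m := by omega
  have h9 : (m : ℚ) * m ≤ 2 * p + m := by exact_mod_cast h8
  push_cast
  linarith

end
end
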